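/- The commuter of B = A[X;*]^fl is C(B) = { Σ_i a_i X^i : each a_i lies in C_*(A) = {a ∈ C(A) : a* = a}, and every odd-indexed coefficient satisfies a_{2i+1}·b* = a_{2i+1}·b for all b ∈ A }. -/

import Mathlib

/-- `tau n a b = ab` if `n` is even and `ba` if `n` is odd. -/
def tau {A : Type*} [NonAssocRing A] (n : ℕ) (a b : A) : A :=
  if Even n then a * b else b * a

/-- The `m`-fold iterate `*^m` of the involution `*`. -/
def starIter {A : Type*} [NonAssocRing A] [StarRing A] : ℕ → A → A
  | 0, a => a
  | m+1, a => star (starIter m a)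

/-- The multiplication of the flipped non-associative skew polynomial ring `B = A[X;*]^fl`:
the biadditive extension of `(aX^m)(bX^n) = τ_n(a, *^m(b)) X^{m+n}`. Polynomials are
represented as finitely supported functions `ℕ →₀ A`. -/
noncomputable def fmul {A : Type*} [NonAssocRing A] [StarRing A] (p q : ℕ →₀ A) : ℕ →₀ A :=
  p.sum fun m a => q.sum fun n b => Finsupp.single (m+n) (tau n a (starIter m b))

/-- The map `α : B → B`, `α(Σ_i a_i X^i) = Σ_i (−1)^i *^{i+1}(a_i) X^i`. -/
noncomputable def alphaMap {A : Type*} [NonAssocRing A] [StarRing A] (p : ℕ →₀ A) : ℕ →₀ A :=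
  p.sum fun i a => Finsupp.single i ((-1 : ℤ) ^ i • starIter (i+1) a)

/-- The map `β : B → B`, `β(Σ_i a_i X^i) = Σ_i *^{i+1}(a_i) X^i`. -/
noncomputable def betaMap {A : Type*} [NonAssocRing A] [StarRing A] (p : ℕ →₀ A) : ℕ →₀ A :=
  p.sum fun i a => Finsupp.single i (starIter (i+1) a)

@[simp] lemma tau_zero_left {A : Type*} [NonAssocRing A] (n : ℕ) (b : A) : tau n 0 b = 0 := by simp [tau]

@[simp] lemma tau_zero_right {A : Type*} [NonAssocRing A] (n : ℕ) (a : A) : tau n a 0 = 0 := by simp [tau]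

section Helpers

variable {A : Type*} [NonAssocRing A] [StarRing A]

lemma starIter_of_even {n : ℕ} (hn : Even n) (a : A) : starIter n a = a := by
  obtain ⟨k, rfl⟩ := hn
  induction k with
  | zero => rfl
  | succ k ih =>
    rw [show k + 1 + (k + 1) = k + k + 1 + 1 by omega]
    simp [starIter, ih]

lemma starIter_of_odd {n : ℕ} (hn : Odd n) (a : A) : starIter n a = star a := by
  obtain ⟨k, rfl⟩ := hn
  exact congrArg star (starIter_of_even (even_two_mul k) a)

lemma starIter_of_star_eq {a : A} (ha : star a = a) (n : ℕ) : starIter n a = a := by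
  rcases n.even_or_odd with h | h
  · exact starIter_of_even h a
  · rw [starIter_of_odd h, ha]

@[simp] lemma starIter_zero_right (n : ℕ) : starIter n (0 : A) = 0 :=
  starIter_of_star_eq (star_zero A) n

lemma fmul_single_right_apply (p : ℕ →₀ A) (m n : ℕ) (b : A) :
    fmul p (Finsupp.single n b) (m + n) = tau n (p m) (starIter m b) := by
  simp only [fmul, Finsupp.sum_single_index, tau_zero_right, starIter_zero_right,
    Finsupp.single_zero]
  rw [Finsupp.sum_apply, Finsupp.sum_eq_single m]
  · simp
  · intro k _ hk
    exact Finsupp.single_eq_of_ne (by omega)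
  · simp

lemma fmul_single_left_apply (p : ℕ →₀ A) (m n : ℕ) (b : A) :
    fmul (Finsupp.single n b) p (m + n) = tau m b (starIter n (p m)) := by
  rw [fmul, Finsupp.sum_single_index (by simp), Finsupp.sum_apply, Finsupp.sum_eq_single m]
  · simp [add_comm]
  · intro k _ hk
    exact Finsupp.single_eq_of_ne (by omega)
  · simp

lemma fmul_comm_of_coeff {p q : ℕ →₀ A}
    (h : ∀ m n, tau n (p m) (starIter m (q n)) = tau m (q n) (starIter n (p m))) :
    fmul p q = fmul q p := by
  rw [fmul, fmul, Finsupp.sum_comm]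
  refine Finsupp.sum_congr fun n _ => Finsupp.sum_congr fun m _ => ?_
  rw [h, add_comm]

lemma coeff_of_fmul_comm {p : ℕ →₀ A} (h : ∀ q, fmul p q = fmul q p) (m n : ℕ) (b : A) :
    tau n (p m) (starIter m b) = tau m b (starIter n (p m)) := by
  rw [← fmul_single_right_apply, h, fmul_single_left_apply]

end Helpers

/-- the commuter of `B = A[X;*]^fl` consists of the polynomials `Σ_i a_i X^i`
whose coefficients all lie in `C_*(A) = {a ∈ C(A) : a* = a}` and whose odd-indexed
coefficients satisfy `a_{2i+1} b* = a_{2i+1} b` for all `b ∈ A`. -/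
theorem commuter_flipped_skew_polynomial_ring
    {A : Type*} [NonAssocRing A] [StarRing A] :
    ∀ p : ℕ →₀ A,
      (∀ q : ℕ →₀ A, fmul p q = fmul q p) ↔
        ((∀ i : ℕ, (∀ b : A, p i * b = b * p i) ∧ star (p i) = p i) ∧
         (∀ (i : ℕ) (b : A), p (2 * i + 1) * star b = p (2 * i + 1) * b)) := by
  intro p
  constructor
  · intro h
    have h_zero (m : ℕ) (b : A) := coeff_of_fmul_comm h m 0 b
    have h_one (m : ℕ) (b : A) := coeff_of_fmul_comm h m 1 b
    have h_odd {m : ℕ} (hm : Odd m) (b : A) : p m * star b = p m * b := by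
      simpa [tau, starIter, starIter_of_odd hm, Nat.not_even_iff_odd.mpr hm] using h_zero m b
    have h_star (m : ℕ) : star (p m) = p m := by
      rcases m.even_or_odd with hm | hm
      · simpa [tau, starIter, starIter_of_even hm, hm] using (h_one m 1).symm
      · simpa [tau, starIter, starIter_of_odd hm, Nat.not_even_iff_odd.mpr hm] using (h_one m 1).symm
    refine ⟨fun m => ⟨fun b => ?_, h_star m⟩, fun i b => h_odd (odd_two_mul_add_one i) b⟩
    rcases m.even_or_odd with hm | hm
    · simpa [tau, starIter, starIter_of_even hm, hm] using h_zero m b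
    · have hb : b * p m = p m * star b := by
        simpa [tau, starIter, starIter_of_odd hm, Nat.not_even_iff_odd.mpr hm, h_star m]
          using h_one m (star b)
      rw [hb, h_odd hm]
  · rintro ⟨h_comm, h_odd⟩ q
    refine fmul_comm_of_coeff fun m n => ?_
    have h_tau_left (b : A) : tau n (p m) b = p m * b := by
      simp [tau, (h_comm m).1 b]
    have h_tau_right (b : A) : tau m b (p m) = p m * b := by
      simp [tau, (h_comm m).1 b]
    rw [starIter_of_star_eq (h_comm m).2, h_tau_left, h_tau_right]
    rcases m.even_or_odd with hm | hm
    · rw [starIter_of_even hm]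
    · rw [starIter_of_odd hm]
      obtain ⟨k, rfl⟩ := hm
      exact h_odd k _
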